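/- Let d ≥ 1, let C be a positive definite real d×d matrix, and let B ⊆ ℝ^d be a Borel measurable set that is star-shaped with respect to the origin (i.e., t·θ ∈ B for every θ ∈ B and every t ∈ [0,1]). For η > 0 define p(η) = ∫_B (2π)^{-d/2} (det(ηC))^{-1/2} exp(-(1/2) θᵀ (ηC)⁻¹ θ) dθ. Then p is a decreasing function of η: for all 0 < η₁ ≤ η₂ one has p(η₂) ≤ p(η₁). -/

import Mathlib

open MeasureTheory Real Matrix

open scoped Pointwise in
/-- The integral of a nonnegative integrable function over a set that is star-shaped about the
origin does not increase when the function is contracted with the Jacobian factor. -/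
theorem setIntegral_comp_smul_le_of_starShaped {E : Type*} [NormedAddCommGroup E]
    [NormedSpace ℝ E] [FiniteDimensional ℝ E] [MeasurableSpace E] [BorelSpace E]
    (μ : Measure E) [μ.IsAddHaarMeasure] {f : E → ℝ} (hf : Integrable f μ) (hf0 : ∀ x, 0 ≤ f x)
    {s : Set E} (hstar : ∀ x ∈ s, ∀ t : ℝ, t ∈ Set.Icc (0 : ℝ) 1 → t • x ∈ s)
    {r : ℝ} (hr : 0 < r) (hr1 : r ≤ 1) :
    ∫ x in s, r ^ Module.finrank ℝ E * f (r • x) ∂μ ≤ ∫ x in s, f x ∂μ := by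
  have hsub : r • s ⊆ s := by
    rintro _ ⟨x, hx, rfl⟩
    exact hstar x hx r ⟨hr.le, hr1⟩
  rw [integral_const_mul, Measure.setIntegral_comp_smul_of_pos μ f s hr, smul_eq_mul,
    mul_inv_cancel_left₀ (pow_pos hr _).ne']
  exact setIntegral_mono_set hf.integrableOn (ae_of_all _ hf0) hsub.eventuallyLE

namespace Matrix.PosDef

variable {n : Type*} [Fintype n]

/-- A positive definite quadratic form dominates a positive multiple of the squared norm. -/
theorem exists_pos_mul_sq_norm_le {A : Matrix n n ℝ} (hA : A.PosDef) :
    ∃ c > 0, ∀ x : EuclideanSpace ℝ n, c * ‖x‖ ^ 2 ≤ x.ofLp ⬝ᵥ A *ᵥ x.ofLp := by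
  rcases isEmpty_or_nonempty n with hn | hn
  · exact ⟨1, one_pos, fun x ↦ by simp [Subsingleton.elim x 0]⟩
  have hcont : Continuous fun x : EuclideanSpace ℝ n ↦ x.ofLp ⬝ᵥ A *ᵥ x.ofLp := by fun_prop
  obtain ⟨x₀, hx₀, hmin⟩ := (isCompact_sphere (0 : EuclideanSpace ℝ n) 1).exists_isMinOn
    (NormedSpace.sphere_nonempty.mpr zero_le_one) hcont.continuousOn
  have hx₀' : x₀.ofLp ≠ 0 := by
    intro h
    have : x₀ = 0 := by ext i; simp [h]
    simp [this] at hx₀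
  refine ⟨_, hA.dotProduct_mulVec_pos hx₀', fun x ↦ ?_⟩
  rcases eq_or_ne x 0 with rfl | hx
  · simp
  have hnorm : 0 < ‖x‖ := norm_pos_iff.mpr hx
  have hunit : ‖x‖⁻¹ • x ∈ Metric.sphere (0 : EuclideanSpace ℝ n) 1 := by
    simp [norm_smul, hnorm.ne']
  have hle := isMinOn_iff.mp hmin _ hunit
  simp only [WithLp.ofLp_smul, mulVec_smul, dotProduct_smul, smul_dotProduct, smul_eq_mul] at hle
  rw [← mul_assoc, ← mul_inv, ← sq, inv_mul_eq_div, le_div_iff₀ (by positivity)] at hle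
  simpa using hle

theorem integrable_exp_neg_half_dotProduct_mulVec {A : Matrix n n ℝ} (hA : A.PosDef) :
    Integrable fun x : EuclideanSpace ℝ n ↦ Real.exp (-(1 / 2) * (x.ofLp ⬝ᵥ A *ᵥ x.ofLp)) := by
  obtain ⟨c, hc, hle⟩ := hA.exists_pos_mul_sq_norm_le
  have hint := (GaussianFourier.integrable_cexp_neg_mul_sq_norm_add (V := EuclideanSpace ℝ n)
    (b := ((c / 2 : ℝ) : ℂ)) (by simpa using hc) 0 0).norm
  refine hint.mono' (by fun_prop) (ae_of_all _ fun x ↦ ?_)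
  rw [Complex.norm_exp, Real.norm_eq_abs, Real.abs_exp, Real.exp_le_exp]
  have hre : (-((c / 2 : ℝ) : ℂ) * (‖x‖ : ℂ) ^ 2 + 0 * (inner ℝ 0 x : ℝ)).re
      = -(c / 2) * ‖x‖ ^ 2 := by
    rw [zero_mul, add_zero]
    norm_cast
  rw [hre]
  linarith [hle x]

variable [DecidableEq n]

theorem dotProduct_inv_sq_smul_mulVec {S : Matrix n n ℝ} (hS : S.PosDef) {r : ℝ} (hr : r ≠ 0)
    (x : n → ℝ) : (r • x) ⬝ᵥ (r ^ 2 • S)⁻¹ *ᵥ (r • x) = x ⬝ᵥ S⁻¹ *ᵥ x := by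
  have hinv : (r ^ 2 • S)⁻¹ = (r ^ 2)⁻¹ • S⁻¹ :=
    Matrix.inv_smul' S (Units.mk0 (r ^ 2) (pow_ne_zero 2 hr)) hS.det_pos.ne'.isUnit
  simp only [hinv, smul_mulVec, mulVec_smul, dotProduct_smul, smul_dotProduct, smul_eq_mul]
  field_simp

theorem pow_mul_det_sq_smul_rpow {S : Matrix n n ℝ} (hS : S.PosDef) {r : ℝ} (hr : 0 < r) :
    r ^ Fintype.card n * (r ^ 2 • S).det ^ (-(1 : ℝ) / 2) = S.det ^ (-(1 : ℝ) / 2) := by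
  have hpow : ((r ^ 2) ^ Fintype.card n) ^ (-(1 : ℝ) / 2) = (r ^ Fintype.card n)⁻¹ := by
    rw [← pow_mul, mul_comm, pow_mul, ← Real.rpow_natCast _ 2, ← Real.rpow_mul (by positivity),
      ← Real.rpow_neg_one]
    norm_num
  rw [det_smul, Real.mul_rpow (by positivity) hS.det_pos.le, hpow,
    mul_inv_cancel_left₀ (pow_pos hr _).ne']

end Matrix.PosDef


/-- Proposition 3: the Gaussian probability mass of a star-shaped (about the origin)
Borel set `B`, with covariance `η • C` for positive definite `C`, is decreasing in `η`. -/
theorem stmt_0 (d : ℕ) (hd : 1 ≤ d)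
    (C : Matrix (Fin d) (Fin d) ℝ) (hC : C.PosDef)
    (B : Set (EuclideanSpace ℝ (Fin d))) (hB : MeasurableSet B)
    (hstar : ∀ θ ∈ B, ∀ t : ℝ, t ∈ Set.Icc (0 : ℝ) 1 → t • θ ∈ B)
    (p : ℝ → ℝ)
    (hp : ∀ η : ℝ, 0 < η → p η =
      ∫ θ in B, (2 * Real.pi) ^ (-(d : ℝ) / 2) * (Matrix.det (η • C)) ^ (-(1 : ℝ) / 2) *
        Real.exp (-(1 / 2) * ((θ : Fin d → ℝ) ⬝ᵥ ((η • C)⁻¹).mulVec (θ : Fin d → ℝ))))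
    (η₁ η₂ : ℝ) (hη₁ : 0 < η₁) (hη₁₂ : η₁ ≤ η₂) :
    p η₂ ≤ p η₁ := by
  have hη₂ : 0 < η₂ := hη₁.trans_le hη₁₂
  obtain ⟨r, hr, hr1, hη⟩ : ∃ r : ℝ, 0 < r ∧ r ≤ 1 ∧ η₁ = r ^ 2 * η₂ := by
    refine ⟨√(η₁ / η₂), by positivity, ?_, ?_⟩
    · exact Real.sqrt_le_one.mpr ((div_le_one hη₂).mpr hη₁₂)
    · rw [Real.sq_sqrt (by positivity), div_mul_cancel₀ _ hη₂.ne']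
  have hS : (η₂ • C).PosDef := hC.smul hη₂
  have hT : (r ^ 2 • η₂ • C).PosDef := hS.smul (pow_pos hr 2)
  rw [hp η₁ hη₁, hp η₂ hη₂, hη, mul_smul]
  have hmono := setIntegral_comp_smul_le_of_starShaped volume
    (hT.inv.integrable_exp_neg_half_dotProduct_mulVec.const_mul
      ((2 * Real.pi) ^ (-(d : ℝ) / 2) * (r ^ 2 • η₂ • C).det ^ (-(1 : ℝ) / 2)))
    (fun x ↦ mul_nonneg (mul_nonneg (by positivity) (Real.rpow_nonneg hT.det_pos.le _))
      (Real.exp_pos _).le) hstar hr hr1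
  convert! hmono using 3 with θ
  rw [WithLp.ofLp_smul, hS.dotProduct_inv_sq_smul_mulVec hr.ne', ← hS.pow_mul_det_sq_smul_rpow hr,
    finrank_euclideanSpace]
  ring
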